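/- Let Ω ⊆ ℝⁿ be a nonempty bounded open set and σ a real number with 0 < σ < 1. Let f : ℝⁿ → ℝ be continuous and bounded on the closure of Ω, and let ρ : ℝⁿ → ℝ be a function with ρ > 0 on Ω, ρ = 0 on the frontier of Ω, such that ρ is σ-Hölder on the closure of Ω (i.e. |ρ(x) − ρ(y)| ≤ L·‖x−y‖^σ for some L and all x, y in the closure of Ω), and such that ρ(x) ≥ (1/2)·infDist(x, Ωᶜ) for all x ∈ Ω. If the product x ↦ ρ(x)·f(x) is σ-Hölder on the closure of Ω (i.e. |ρ(x)f(x) − ρ(y)f(y)| ≤ C·‖x−y‖^σ for some C and all x, y in the closure of Ω), then there exists a constant K such that for every δ > 0 and all x, y ∈ Ω with infDist(x, Ωᶜ) > δ and infDist(y, Ωᶜ) > δ, one has δ·|f(x) − f(y)| ≤ K·‖x−y‖^σ and δ·|f(x)| ≤ K. -/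

import Mathlib

open Metric

/-- Lemma 4.4 of the paper: if `f` is continuous and bounded on the closure of `Ω`
and `ρ • f` is σ-Hölder for a defining-function-like weight `ρ`, then
`f ∈ H_σ^{(1-σ)}(Ω)`. -/
theorem mem_weighted_holder_of_weight_mul_holder {n : ℕ}
    (Ω : Set (EuclideanSpace ℝ (Fin n))) (hne : Ω.Nonempty)
    (hΩo : IsOpen Ω) (hΩb : Bornology.IsBounded Ω)
    (σ : ℝ) (hσ0 : 0 < σ) (hσ1 : σ < 1)
    (f ρ : EuclideanSpace ℝ (Fin n) → ℝ)
    (hfc : ContinuousOn f (closure Ω))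
    (hfb : ∃ B : ℝ, ∀ x ∈ closure Ω, |f x| ≤ B)
    (hρpos : ∀ x ∈ Ω, 0 < ρ x)
    (hρ0 : ∀ x ∈ frontier Ω, ρ x = 0)
    (hρH : ∃ L : ℝ, ∀ x ∈ closure Ω, ∀ y ∈ closure Ω,
      |ρ x - ρ y| ≤ L * ‖x - y‖ ^ σ)
    (hρlb : ∀ x ∈ Ω, (1 / 2) * infDist x Ωᶜ ≤ ρ x)
    (hprod : ∃ C : ℝ, ∀ x ∈ closure Ω, ∀ y ∈ closure Ω,
      |ρ x * f x - ρ y * f y| ≤ C * ‖x - y‖ ^ σ) :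
    ∃ K : ℝ, ∀ δ : ℝ, 0 < δ → ∀ x ∈ Ω, ∀ y ∈ Ω,
      δ < infDist x Ωᶜ → δ < infDist y Ωᶜ →
      δ * |f x - f y| ≤ K * ‖x - y‖ ^ σ ∧ δ * |f x| ≤ K := by
  obtain ⟨B, hB⟩ := hfb
  obtain ⟨L, hL⟩ := hρH
  obtain ⟨C, hC⟩ := hprod
  obtain ⟨x₀, hx₀⟩ := hne
  obtain ⟨D, hD⟩ := isBounded_iff.1 hΩb
  have hB0 : 0 ≤ B := (abs_nonneg _).trans (hB x₀ (subset_closure hx₀))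
  have hD0 : 0 ≤ D := dist_nonneg.trans (hD hx₀ hx₀)
  have hM : ∀ x ∈ Ω, ρ x ≤ ρ x₀ + |L| * D ^ σ := fun x hx => by
    have hpow : ‖x - x₀‖ ^ σ ≤ D ^ σ :=
      Real.rpow_le_rpow (norm_nonneg _) (dist_eq_norm x x₀ ▸ hD hx hx₀) hσ0.le
    have hLx : L * ‖x - x₀‖ ^ σ ≤ |L| * D ^ σ :=
      mul_le_mul (le_abs_self L) hpow (by positivity) (abs_nonneg L)
    linarith [le_abs_self (ρ x - ρ x₀), hL x (subset_closure hx) x₀ (subset_closure hx₀)]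
  have hM0 : 0 ≤ ρ x₀ + |L| * D ^ σ := (hρpos x₀ hx₀).le.trans (hM x₀ hx₀)
  have hK₁ : 0 ≤ 2 * (|C| + B * |L|) := by positivity
  have hK₂ : 0 ≤ 2 * (ρ x₀ + |L| * D ^ σ) * B := by positivity
  refine ⟨2 * (|C| + B * |L|) + 2 * (ρ x₀ + |L| * D ^ σ) * B, ?_⟩
  intro δ _ x hx y hy hδx _
  have hx' := subset_closure hx
  have hy' := subset_closure hy
  have hδρ : δ ≤ 2 * ρ x := by linarith [hρlb x hx]
  have ht : 0 ≤ ‖x - y‖ ^ σ := by positivity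
  constructor
  · have hprod_xy : |ρ x * f x - ρ y * f y| ≤ |C| * ‖x - y‖ ^ σ :=
      (hC x hx' y hy').trans (mul_le_mul_of_nonneg_right (le_abs_self C) ht)
    have hρ_xy : |ρ x - ρ y| ≤ |L| * ‖x - y‖ ^ σ :=
      (hL x hx' y hy').trans (mul_le_mul_of_nonneg_right (le_abs_self L) ht)
    have hmain : ρ x * |f x - f y| ≤ (|C| + B * |L|) * ‖x - y‖ ^ σ :=
      calc ρ x * |f x - f y|
          = |(ρ x * f x - ρ y * f y) - f y * (ρ x - ρ y)| := by
            rw [← abs_of_pos (hρpos x hx), ← abs_mul, abs_of_pos (hρpos x hx)]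
            congr 1
            ring
        _ ≤ |ρ x * f x - ρ y * f y| + |f y| * |ρ x - ρ y| := by
            rw [← abs_mul]
            exact abs_sub _ _
        _ ≤ |C| * ‖x - y‖ ^ σ + B * (|L| * ‖x - y‖ ^ σ) :=
            add_le_add hprod_xy (mul_le_mul (hB y hy') hρ_xy (abs_nonneg _) hB0)
        _ = (|C| + B * |L|) * ‖x - y‖ ^ σ := by ring
    calc δ * |f x - f y| ≤ 2 * ρ x * |f x - f y| :=
          mul_le_mul_of_nonneg_right hδρ (abs_nonneg _)
      _ ≤ 2 * (|C| + B * |L|) * ‖x - y‖ ^ σ := by linarith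
      _ ≤ _ := mul_le_mul_of_nonneg_right (by linarith) ht
  · calc δ * |f x| ≤ 2 * (ρ x₀ + |L| * D ^ σ) * B :=
          mul_le_mul (by linarith [hM x hx]) (hB x hx') (abs_nonneg _) (by linarith)
      _ ≤ _ := by linarith
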